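/- arXiv:2202.10009 — 2 statements merged into one kernel-verified Lean document; each statement's English description precedes it below -/
import Mathlib

section
/- Let V be a variety that has a Taylor term. The following are equivalent: (1) V has a difference term; (2) the centralizer relation is weakly stable under lifting in its third place throughout V, i.e., for all congruences x, y, z, z' on any algebra in V, if C(x,y;z) holds and z ≤ z' ≤ x ∩ y, then C(x,y;z') holds. -/
/-- A (universal-algebraic) signature: a type of operation symbols with arities. -/
structure Sig where
  ops : Type
  arity : ops → ℕ

/-- An algebra for a signature: a carrier set with an interpretation of each
operation symbol. -/
structure Alg (σ : Sig) where
  carrier : Type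
  interp : ∀ f : σ.ops, (Fin (σ.arity f) → carrier) → carrier

/-- Terms over a signature with variables from `V`. -/
inductive Trm (σ : Sig) (V : Type) : Type
  | var : V → Trm σ V
  | op : (f : σ.ops) → (Fin (σ.arity f) → Trm σ V) → Trm σ V

/-- Evaluation of a term in an algebra under an assignment of the variables. -/
def Alg.evalTrm {σ : Sig} (A : Alg σ) {V : Type} (asg : V → A.carrier) :
    Trm σ V → A.carrier
  | .var v => asg v
  | .op f ts => A.interp f fun i => A.evalTrm asg (ts i)

/-- A congruence on an algebra: an equivalence relation compatible with the
basic operations. -/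
structure Congruence {σ : Sig} (A : Alg σ) where
  rel : A.carrier → A.carrier → Prop
  iseqv : Equivalence rel
  compat : ∀ (f : σ.ops) (a b : Fin (σ.arity f) → A.carrier),
    (∀ i, rel (a i) (b i)) → rel (A.interp f a) (A.interp f b)

namespace Congruence

variable {σ : Sig} {A : Alg σ}

theorem ext' {c d : Congruence A} (h : c.rel = d.rel) : c = d := by
  cases c; cases d; cases h; rfl

instance : PartialOrder (Congruence A) where
  le c d := ∀ a b, c.rel a b → d.rel a b
  le_refl c a b h := h
  le_trans c d e h1 h2 a b h := h2 a b (h1 a b h)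
  le_antisymm c d h1 h2 :=
    ext' (funext fun a => funext fun b => propext ⟨h1 a b, h2 a b⟩)

instance : InfSet (Congruence A) where
  sInf S :=
    { rel := fun a b => ∀ c ∈ S, c.rel a b
      iseqv := ⟨fun a c _ => c.iseqv.refl a,
                fun h c hc => c.iseqv.symm (h c hc),
                fun h1 h2 c hc => c.iseqv.trans (h1 c hc) (h2 c hc)⟩
      compat := fun f a b h c hc => c.compat f a b fun i => h i c hc }

/-- The congruences of an algebra form a complete lattice (`⊥` is the equality
congruence, `⊤` is the total congruence, meet is intersection). -/
instance : CompleteLattice (Congruence A) :=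
  completeLatticeOfInf _ fun S =>
    ⟨fun c hc a b h => h c hc, fun c hc a b h d hd => hc hd a b h⟩

end Congruence

/-- `Centralizes S T δ` is the centralizer relation `C(S,T;δ)`: for every
`S,T`-matrix `[[p,q],[r,s]]` (built from a term operation `t`, tuples `a S b`
and `u T v`), if `(p,q) ∈ δ` then `(r,s) ∈ δ`. -/
def Centralizes {σ : Sig} {A : Alg σ} (S T δ : Congruence A) : Prop :=
  ∀ (m n : ℕ) (t : Trm σ (Sum (Fin m) (Fin n)))
    (a b : Fin m → A.carrier) (u v : Fin n → A.carrier),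
    (∀ i, S.rel (a i) (b i)) → (∀ j, T.rel (u j) (v j)) →
    δ.rel (A.evalTrm (Sum.elim a u) t) (A.evalTrm (Sum.elim a v) t) →
    δ.rel (A.evalTrm (Sum.elim b u) t) (A.evalTrm (Sum.elim b v) t)

/-- The commC `[S,T]`: the least congruence `δ` with `C(S,T;δ)`. -/
def commC {σ : Sig} {A : Alg σ} (S T : Congruence A) : Congruence A :=
  sInf {δ | Centralizes S T δ}

/-- The relative commC `[S,T]_ε`: the intersection of all congruences
`γ ≥ ε` with `C(S,T;γ)`. -/
def relCommC {σ : Sig} {A : Alg σ} (S T ε : Congruence A) : Congruence A :=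
  sInf {γ | ε ≤ γ ∧ Centralizes S T γ}

/-- The congruence generated by a single pair `(x, y)`. -/
def cgPair {σ : Sig} (A : Alg σ) (x y : A.carrier) : Congruence A :=
  sInf {c | c.rel x y}

/-- Homomorphisms of algebras. -/
structure UAHom {σ : Sig} (A B : Alg σ) where
  toFun : A.carrier → B.carrier
  map_op : ∀ (f : σ.ops) (a : Fin (σ.arity f) → A.carrier),
    toFun (A.interp f a) = B.interp f (fun i => toFun (a i))

/-- The product of a family of algebras. -/
def prodAlg {σ : Sig} {I : Type} (F : I → Alg σ) : Alg σ where
  carrier := ∀ i, (F i).carrier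
  interp f a := fun i => (F i).interp f (fun j => a j i)

/-- A variety: a class of algebras of a fixed signature closed under
homomorphic images, subalgebras (here: isomorphic copies of subalgebras,
i.e. sources of injective homomorphisms), and arbitrary products. -/
structure Variety (σ : Sig) where
  Mem : Alg σ → Prop
  closed_hom : ∀ {A B : Alg σ}, Mem A →
    (∃ h : UAHom A B, Function.Surjective h.toFun) → Mem B
  closed_sub : ∀ {A B : Alg σ}, Mem A →
    (∃ h : UAHom B A, Function.Injective h.toFun) → Mem B
  closed_prod : ∀ {I : Type} (F : I → Alg σ), (∀ i, Mem (F i)) → Mem (prodAlg F)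

/-- The setoid associated with a congruence. -/
def Congruence.setoid {σ : Sig} {A : Alg σ} (c : Congruence A) :
    Setoid A.carrier := ⟨c.rel, c.iseqv⟩

/-- The quotient algebra of an algebra by a congruence. -/
noncomputable def quotAlg {σ : Sig} (A : Alg σ) (c : Congruence A) : Alg σ where
  carrier := Quotient c.setoid
  interp f a := Quotient.mk c.setoid (A.interp f fun i => (a i).out)

/-- `algOn A α` is the algebra `A(α)`: the subalgebra of `A × A` whose
universe is `α`. -/
def algOn {σ : Sig} (A : Alg σ) (α : Congruence A) : Alg σ where
  carrier := {p : A.carrier × A.carrier // α.rel p.1 p.2}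
  interp f a := ⟨(A.interp f fun i => (a i).1.1, A.interp f fun i => (a i).1.2),
    α.compat f _ _ fun i => (a i).2⟩

/-- The kernel of the first coordinate projection of `A(α)`. -/
def eta1 {σ : Sig} (A : Alg σ) (α : Congruence A) : Congruence (algOn A α) where
  rel p q := p.1.1 = q.1.1
  iseqv := ⟨fun _ => rfl, Eq.symm, Eq.trans⟩
  compat f a b h := congrArg (A.interp f) (funext h)

/-- The kernel of the second coordinate projection of `A(α)`. -/
def eta2 {σ : Sig} (A : Alg σ) (α : Congruence A) : Congruence (algOn A α) where
  rel p q := p.1.2 = q.1.2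
  iseqv := ⟨fun _ => rfl, Eq.symm, Eq.trans⟩
  compat f a b h := congrArg (A.interp f) (funext h)

/-- The congruence `Δ_{α,β}` on `A(α)` generated by the `β`-diagonal pairs. -/
def diagDelta {σ : Sig} (A : Alg σ) (α β : Congruence A) :
    Congruence (algOn A α) :=
  sInf {c | ∀ x z : A.carrier, β.rel x z →
    c.rel ⟨(x, x), α.iseqv.refl x⟩ ⟨(z, z), α.iseqv.refl z⟩}

/-- A pentagon (five-element sublattice isomorphic to `N₅`) in the congruence
lattice with bottom `z`, side element `β`, critical chain `δ < θ`, and top `α`. -/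
def IsPentagon {σ : Sig} {A : Alg σ} (z β δ θ α : Congruence A) : Prop :=
  δ < θ ∧ β ⊓ θ = z ∧ β ⊓ δ = z ∧ β ⊔ δ = α ∧ β ⊔ θ = α

/-- Two congruences permute: `c ∘ d = d ∘ c`. -/
def Permutes {σ : Sig} {A : Alg σ} (c d : Congruence A) : Prop :=
  ∀ a b : A.carrier, (∃ x, c.rel a x ∧ d.rel x b) ↔ (∃ x, d.rel a x ∧ c.rel x b)

/-- `T` is a Taylor term for the variety `V`: an idempotent term satisfying an
`i`-th place Taylor identity for every place `i`. -/
def IsTaylorTrm {σ : Sig} (V : Variety σ) {n : ℕ} (T : Trm σ (Fin n)) : Prop :=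
  0 < n ∧
  (∀ A : Alg σ, V.Mem A → ∀ c : A.carrier, A.evalTrm (fun _ => c) T = c) ∧
  (∀ i : Fin n, ∃ w z : Fin n → Bool, w i ≠ z i ∧
    ∀ A : Alg σ, V.Mem A → ∀ x y : A.carrier,
      A.evalTrm (fun j => cond (w j) x y) T = A.evalTrm (fun j => cond (z j) x y) T)

/-- `V` has a Taylor term. -/
def HasTaylorTrm {σ : Sig} (V : Variety σ) : Prop :=
  ∃ (n : ℕ) (T : Trm σ (Fin n)), IsTaylorTrm V T

/-- A congruence is abelian if `[α,α] = 0`. -/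
def IsAbelianCong {σ : Sig} {A : Alg σ} (α : Congruence A) : Prop :=
  commC α α = ⊥

/-- `d` is a weak difference term for `V`: `d(a,a,b) = b` and `d(a,b,b) = a`
whenever the pair `(a,b)` lies in an abelian congruence of a member of `V`. -/
def IsWeakDifferenceTrm {σ : Sig} (V : Variety σ) (d : Trm σ (Fin 3)) : Prop :=
  ∀ A : Alg σ, V.Mem A → ∀ α : Congruence A, IsAbelianCong α →
    ∀ a b : A.carrier, α.rel a b →
      A.evalTrm ![a, a, b] d = b ∧ A.evalTrm ![a, b, b] d = a

/-- `d` is a difference term for `V`: `V ⊨ d(x,x,y) ≈ y` and `d(a,b,b) = a`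
whenever the pair `(a,b)` lies in an abelian congruence of a member of `V`. -/
def IsDifferenceTrm {σ : Sig} (V : Variety σ) (d : Trm σ (Fin 3)) : Prop :=
  (∀ A : Alg σ, V.Mem A → ∀ a b : A.carrier, A.evalTrm ![a, a, b] d = b) ∧
  (∀ A : Alg σ, V.Mem A → ∀ α : Congruence A, IsAbelianCong α →
    ∀ a b : A.carrier, α.rel a b → A.evalTrm ![a, b, b] d = a)

/-- The commC is left distributive throughout `V`. -/
def CommLeftDistrib {σ : Sig} (V : Variety σ) : Prop :=
  ∀ A : Alg σ, V.Mem A → ∀ x y z : Congruence A,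
    commC (x ⊔ y) z = commC x z ⊔ commC y z

/-- The commC is right distributive throughout `V`. -/
def CommRightDistrib {σ : Sig} (V : Variety σ) : Prop :=
  ∀ A : Alg σ, V.Mem A → ∀ x y z : Congruence A,
    commC x (y ⊔ z) = commC x y ⊔ commC x z

/-- The commC is commutative throughout `V`. -/
def CommutativeCommutator {σ : Sig} (V : Variety σ) : Prop :=
  ∀ A : Alg σ, V.Mem A → ∀ x y : Congruence A, commC x y = commC y x

/-- `V` is congruence modular. -/
def CongruenceModular {σ : Sig} (V : Variety σ) : Prop :=
  ∀ A : Alg σ, V.Mem A → IsModularLattice (Congruence A)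


/-! ### Auxiliary material for the proof -/

section Aux

variable {σ : Sig}

/-- Simultaneous substitution. -/
def Trm.sbst {X Y : Type} (τ : X → Trm σ Y) : Trm σ X → Trm σ Y
  | .var v => τ v
  | .op f ts => .op f fun i => Trm.sbst τ (ts i)

theorem evalTrm_sbst (A : Alg σ) {X Y : Type} (asg : Y → A.carrier) (τ : X → Trm σ Y)
    (t : Trm σ X) :
    A.evalTrm asg (t.sbst τ) = A.evalTrm (fun v => A.evalTrm asg (τ v)) t := by
  induction t with
  | var v => rfl
  | op f ts ih => exact congrArg (A.interp f) (funext fun i => ih i)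

theorem hom_eval {A B : Alg σ} (h : UAHom A B) {X : Type} (asg : X → A.carrier)
    (t : Trm σ X) :
    h.toFun (A.evalTrm asg t) = B.evalTrm (fun v => h.toFun (asg v)) t := by
  induction t with
  | var v => rfl
  | op f ts ih =>
    show h.toFun (A.interp f _) = B.interp f _
    rw [h.map_op]
    exact congrArg (B.interp f) (funext fun i => ih i)

/-- Compatibility of a relation with the basic operations. -/
def Compat (A : Alg σ) (ρ : A.carrier → A.carrier → Prop) : Prop :=
  ∀ (f : σ.ops) (a b : Fin (σ.arity f) → A.carrier),
    (∀ i, ρ (a i) (b i)) → ρ (A.interp f a) (A.interp f b)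

theorem Compat.eval {A : Alg σ} {ρ : A.carrier → A.carrier → Prop} (h : Compat A ρ)
    {X : Type} {a b : X → A.carrier} (t : Trm σ X) (hab : ∀ v, ρ (a v) (b v)) :
    ρ (A.evalTrm a t) (A.evalTrm b t) := by
  induction t with
  | var v => exact hab v
  | op f ts ih => exact h f _ _ fun i => ih i

/-- Application of a ternary term. -/
def ap3 (A : Alg σ) (t : Trm σ (Fin 3)) (a b c : A.carrier) : A.carrier :=
  A.evalTrm ![a, b, c] t

/-- Application of a quaternary term. -/
def ap4 (A : Alg σ) (t : Trm σ (Fin 4)) (a b c d : A.carrier) : A.carrier :=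
  A.evalTrm ![a, b, c, d] t

/-- Substitution in a ternary term. -/
def sb3 {X : Type} (t : Trm σ (Fin 3)) (a b c : Trm σ X) : Trm σ X := t.sbst ![a, b, c]

/-- Substitution in a quaternary term. -/
def sb4 {X : Type} (t : Trm σ (Fin 4)) (a b c d : Trm σ X) : Trm σ X := t.sbst ![a, b, c, d]

theorem eval_sb3 (A : Alg σ) {X : Type} (asg : X → A.carrier) (t : Trm σ (Fin 3))
    (a b c : Trm σ X) :
    A.evalTrm asg (sb3 t a b c)
      = ap3 A t (A.evalTrm asg a) (A.evalTrm asg b) (A.evalTrm asg c) := by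
  unfold sb3 ap3
  rw [evalTrm_sbst]
  congr 1
  funext i
  fin_cases i <;> rfl

theorem eval_sb4 (A : Alg σ) {X : Type} (asg : X → A.carrier) (t : Trm σ (Fin 4))
    (a b c d : Trm σ X) :
    A.evalTrm asg (sb4 t a b c d)
      = ap4 A t (A.evalTrm asg a) (A.evalTrm asg b) (A.evalTrm asg c) (A.evalTrm asg d) := by
  unfold sb4 ap4
  rw [evalTrm_sbst]
  congr 1
  funext i
  fin_cases i <;> rfl

theorem Compat.ap3 {A : Alg σ} {ρ : A.carrier → A.carrier → Prop} (h : Compat A ρ)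
    (t : Trm σ (Fin 3)) {a b c a' b' c' : A.carrier} (ha : ρ a a') (hb : ρ b b') (hc : ρ c c') :
    ρ (ap3 A t a b c) (ap3 A t a' b' c') := by
  refine h.eval t fun v => ?_
  fin_cases v <;> assumption

theorem Compat.ap4 {A : Alg σ} {ρ : A.carrier → A.carrier → Prop} (h : Compat A ρ)
    (t : Trm σ (Fin 4)) {a b c d a' b' c' d' : A.carrier} (ha : ρ a a') (hb : ρ b b')
    (hc : ρ c c') (hd : ρ d d') :
    ρ (ap4 A t a b c d) (ap4 A t a' b' c' d') := by
  refine h.eval t fun v => ?_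
  fin_cases v <;> assumption

theorem hom_ap3 {A B : Alg σ} (h : UAHom A B) (t : Trm σ (Fin 3)) (a b c : A.carrier) :
    h.toFun (ap3 A t a b c) = ap3 B t (h.toFun a) (h.toFun b) (h.toFun c) := by
  unfold ap3
  rw [hom_eval]
  congr 1
  funext i
  fin_cases i <;> rfl

theorem hom_ap4 {A B : Alg σ} (h : UAHom A B) (t : Trm σ (Fin 4)) (a b c d : A.carrier) :
    h.toFun (ap4 A t a b c d) = ap4 B t (h.toFun a) (h.toFun b) (h.toFun c) (h.toFun d) := by
  unfold ap4
  rw [hom_eval]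
  congr 1
  funext i
  fin_cases i <;> rfl

theorem Congruence.cpt {A : Alg σ} (c : Congruence A) : Compat A c.rel := c.compat

/-- One-coordinate-at-a-time compatibility suffices for quasiorders. -/
theorem compat_of_update {A : Alg σ} {ρ : A.carrier → A.carrier → Prop}
    (hr : ∀ a, ρ a a) (ht : ∀ a b c, ρ a b → ρ b c → ρ a c)
    (hu : ∀ (f : σ.ops) (c : Fin (σ.arity f) → A.carrier) (i : Fin (σ.arity f)) (u v : A.carrier),
      ρ u v → ρ (A.interp f (Function.update c i u)) (A.interp f (Function.update c i v))) :
    Compat A ρ := by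
  intro f a b hab
  classical
  have key : ∀ s : Finset (Fin (σ.arity f)), ρ (A.interp f a) (A.interp f (s.piecewise b a)) := by
    intro s
    induction s using Finset.induction_on with
    | empty => rw [Finset.piecewise_empty]; exact hr _
    | insert i s hi ih =>
      refine ht _ _ _ ih ?_
      have h1 := hu f (s.piecewise b a) i (a i) (b i) (hab i)
      rw [← Finset.piecewise_insert] at h1
      have h2 : Function.update (s.piecewise b a) i (a i) = s.piecewise b a := by
        rw [Function.update_eq_self_iff]
        simp [hi]
      rwa [h2] at h1
  have := key Finset.univ
  rwa [Finset.piecewise_univ] at this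

/-- The equality congruence. -/
def eqCong (A : Alg σ) : Congruence A where
  rel a b := a = b
  iseqv := ⟨fun _ => rfl, Eq.symm, Eq.trans⟩
  compat f a b h := congrArg (A.interp f) (funext h)

/-- `S,T`-matrices, generated inductively. -/
inductive Mat {A : Alg σ} (S T : A.carrier → A.carrier → Prop) :
    A.carrier → A.carrier → A.carrier → A.carrier → Prop
  | row (a b : A.carrier) : S a b → Mat S T a a b b
  | col (u v : A.carrier) : T u v → Mat S T u v u v
  | op (f : σ.ops) (p q r s : Fin (σ.arity f) → A.carrier) :
      (∀ i, Mat S T (p i) (q i) (r i) (s i)) →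
      Mat S T (A.interp f p) (A.interp f q) (A.interp f r) (A.interp f s)

theorem Mat.eval {A : Alg σ} {S T : A.carrier → A.carrier → Prop} {X : Type}
    {p q r s : X → A.carrier} (t : Trm σ X) (h : ∀ v, Mat S T (p v) (q v) (r v) (s v)) :
    Mat S T (A.evalTrm p t) (A.evalTrm q t) (A.evalTrm r t) (A.evalTrm s t) := by
  induction t with
  | var v => exact h v
  | op f ts ih => exact Mat.op f _ _ _ _ fun i => ih i

theorem Mat.ap3 {A : Alg σ} {S T : A.carrier → A.carrier → Prop} (t : Trm σ (Fin 3))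
    {p q r s p' q' r' s' p'' q'' r'' s'' : A.carrier}
    (h : Mat S T p q r s) (h' : Mat S T p' q' r' s') (h'' : Mat S T p'' q'' r'' s'') :
    Mat S T (ap3 A t p p' p'') (ap3 A t q q' q'') (ap3 A t r r' r'') (ap3 A t s s' s'') := by
  refine Mat.eval t fun v => ?_
  fin_cases v <;> assumption

theorem Mat.ap4 {A : Alg σ} {S T : A.carrier → A.carrier → Prop} (t : Trm σ (Fin 4))
    {p q r s p' q' r' s' p'' q'' r'' s'' p3 q3 r3 s3 : A.carrier}
    (h : Mat S T p q r s) (h' : Mat S T p' q' r' s') (h'' : Mat S T p'' q'' r'' s'')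
    (h3 : Mat S T p3 q3 r3 s3) :
    Mat S T (ap4 A t p p' p'' p3) (ap4 A t q q' q'' q3) (ap4 A t r r' r'' r3)
      (ap4 A t s s' s'' s3) := by
  refine Mat.eval t fun v => ?_
  fin_cases v <;> assumption

theorem Mat.map {A B : Alg σ} (h : UAHom A B) {S T : A.carrier → A.carrier → Prop}
    {S' T' : B.carrier → B.carrier → Prop}
    (hS : ∀ a b, S a b → S' (h.toFun a) (h.toFun b))
    (hT : ∀ a b, T a b → T' (h.toFun a) (h.toFun b)) {p q r s : A.carrier}
    (hm : Mat S T p q r s) : Mat S' T' (h.toFun p) (h.toFun q) (h.toFun r) (h.toFun s) := by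
  induction hm with
  | row a b hab => exact Mat.row _ _ (hS _ _ hab)
  | col a b hab => exact Mat.col _ _ (hT _ _ hab)
  | op f p q r s _ ih =>
    simp only [h.map_op]
    exact Mat.op f _ _ _ _ ih

theorem Mat.mono {A : Alg σ} {S T S' T' : A.carrier → A.carrier → Prop}
    (hS : ∀ a b, S a b → S' a b) (hT : ∀ a b, T a b → T' a b) {p q r s : A.carrier}
    (hm : Mat S T p q r s) : Mat S' T' p q r s :=
  Mat.map (⟨id, fun _ _ => rfl⟩ : UAHom A A) hS hT hm

theorem Mat.right {A : Alg σ} {S T : Congruence A} {p q r s : A.carrier}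
    (hm : Mat S.rel T.rel p q r s) : T.rel r s := by
  induction hm with
  | row a b hab => exact T.iseqv.refl _
  | col a b hab => exact hab
  | op f p q r s _ ih => exact T.compat f _ _ ih

theorem Mat.toTrm {A : Alg σ} {S T : A.carrier → A.carrier → Prop} {p q r s : A.carrier}
    (hm : Mat S T p q r s) :
    ∃ (m n : ℕ) (t : Trm σ (Sum (Fin m) (Fin n))) (a b : Fin m → A.carrier)
      (u v : Fin n → A.carrier), (∀ i, S (a i) (b i)) ∧ (∀ j, T (u j) (v j)) ∧
      A.evalTrm (Sum.elim a u) t = p ∧ A.evalTrm (Sum.elim a v) t = q ∧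
      A.evalTrm (Sum.elim b u) t = r ∧ A.evalTrm (Sum.elim b v) t = s := by
  induction hm with
  | row a b hab =>
    exact ⟨1, 0, .var (Sum.inl 0), fun _ => a, fun _ => b, Fin.elim0, Fin.elim0,
      fun _ => hab, fun j => j.elim0, rfl, rfl, rfl, rfl⟩
  | col u v huv =>
    exact ⟨0, 1, .var (Sum.inr 0), Fin.elim0, Fin.elim0, fun _ => u, fun _ => v,
      fun j => j.elim0, fun _ => huv, rfl, rfl, rfl, rfl⟩
  | op f p q r s _ ih =>
    choose m n t a b u v hab huv hp hq hr hs using ih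
    let eM : (Σ i, Fin (m i)) ≃ Fin _ := finSigmaFinEquiv
    let eN : (Σ i, Fin (n i)) ≃ Fin _ := finSigmaFinEquiv
    have key : ∀ (a : ∀ i, Fin (m i) → A.carrier) (u : ∀ i, Fin (n i) → A.carrier),
        A.evalTrm (Sum.elim (fun k => a (eM.symm k).1 (eM.symm k).2)
            (fun k => u (eN.symm k).1 (eN.symm k).2))
          (.op f fun i => (t i).sbst (Sum.elim (fun k => .var (Sum.inl (eM ⟨i, k⟩)))
            (fun k => .var (Sum.inr (eN ⟨i, k⟩)))))
        = A.interp f fun i => A.evalTrm (Sum.elim (a i) (u i)) (t i) := by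
      intro a u
      refine congrArg (A.interp f) (funext fun i => ?_)
      rw [evalTrm_sbst]
      congr 1
      funext k
      have h1 : ∀ x, eM.symm (eM x) = x := eM.symm_apply_apply
      have h2 : ∀ x, eN.symm (eN x) = x := eN.symm_apply_apply
      rcases k with k | k
      · show a (eM.symm (eM ⟨i, k⟩)).1 (eM.symm (eM ⟨i, k⟩)).2 = a i k
        rw [h1]
      · show u (eN.symm (eN ⟨i, k⟩)).1 (eN.symm (eN ⟨i, k⟩)).2 = u i k
        rw [h2]
    refine ⟨_, _, .op f fun i => (t i).sbst (Sum.elim (fun k => .var (Sum.inl (eM ⟨i, k⟩)))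
            (fun k => .var (Sum.inr (eN ⟨i, k⟩)))),
      fun k => a (eM.symm k).1 (eM.symm k).2, fun k => b (eM.symm k).1 (eM.symm k).2,
      fun k => u (eN.symm k).1 (eN.symm k).2, fun k => v (eN.symm k).1 (eN.symm k).2,
      fun k => hab _ _, fun k => huv _ _, ?_, ?_, ?_, ?_⟩
    · rw [key]; exact congrArg _ (funext hp)
    · rw [key]; exact congrArg _ (funext hq)
    · rw [key]; exact congrArg _ (funext hr)
    · rw [key]; exact congrArg _ (funext hs)

/-- The centralizer relation through inductively generated matrices. -/
def CM {A : Alg σ} (S T δ : Congruence A) : Prop :=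
  ∀ p q r s, Mat S.rel T.rel p q r s → δ.rel p q → δ.rel r s

theorem centralizes_iff {A : Alg σ} (S T δ : Congruence A) : Centralizes S T δ ↔ CM S T δ := by
  constructor
  · intro h p q r s hm hpq
    obtain ⟨m, n, t, a, b, u, v, hab, huv, rfl, rfl, rfl, rfl⟩ := hm.toTrm
    exact h m n t a b u v hab huv hpq
  · intro h m n t a b u v hab huv hpq
    refine h _ _ _ _ (Mat.eval t ?_) hpq
    rintro (i | j)
    · exact Mat.row _ _ (hab i)
    · exact Mat.col _ _ (huv j)

theorem CM.mono {A : Alg σ} {S T S' T' δ : Congruence A} (h : CM S T δ) (hS : S' ≤ S)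
    (hT : T' ≤ T) : CM S' T' δ :=
  fun p q r s hm hpq => h p q r s (hm.mono hS hT) hpq

theorem CM.self {A : Alg σ} (S T : Congruence A) : CM S T T :=
  fun _ _ _ _ hm _ => hm.right

theorem CM.comm {A : Alg σ} (S T : Congruence A) : CM S T (commC S T) := by
  intro p q r s hm hpq c hc
  exact (centralizes_iff _ _ _).1 hc _ _ _ _ hm (hpq c hc)

theorem commC_le {A : Alg σ} {S T δ : Congruence A} (h : CM S T δ) : commC S T ≤ δ :=
  fun _ _ hab => hab δ ((centralizes_iff _ _ _).2 h)

theorem isAbelian_iff {A : Alg σ} (α : Congruence A) : IsAbelianCong α ↔ CM α α (eqCong A) := by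
  constructor
  · intro h
    have h1 := CM.comm α α
    have h2 : commC α α = eqCong A := by
      refine le_antisymm ?_ ?_
      · rw [show commC α α = ⊥ from h]; exact bot_le
      · intro a b hab
        have hab' : a = b := hab
        subst hab'
        exact (commC α α).iseqv.refl a
    rwa [h2] at h1
  · intro h
    refine le_antisymm (fun a b hab => ?_) bot_le
    have : a = b := commC_le h a b hab
    subst this
    exact (⊥ : Congruence A).iseqv.refl a

/-! ### Direction (1) to (2) -/

/-- The quotient homomorphism. -/
noncomputable def quotHom (A : Alg σ) (c : Congruence A) : UAHom A (quotAlg A c) where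
  toFun a := Quotient.mk c.setoid a
  map_op f a := by
    refine Quotient.sound (s := c.setoid) (c.compat f _ _ fun i => ?_)
    exact c.iseqv.symm (Quotient.mk_out (s := c.setoid) (a i))

theorem quot_exact {A : Alg σ} {c : Congruence A} {a b : A.carrier}
    (h : (quotHom A c).toFun a = (quotHom A c).toFun b) : c.rel a b :=
  Quotient.exact (s := c.setoid) h

/-- The image of a larger congruence in the quotient. -/
noncomputable def quotCong {A : Alg σ} (c d : Congruence A) (h : c ≤ d) :
    Congruence (quotAlg A c) where
  rel p q := d.rel (Quotient.out p) (Quotient.out q)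
  iseqv := ⟨fun _ => d.iseqv.refl _, fun h => d.iseqv.symm h, fun h h' => d.iseqv.trans h h'⟩
  compat f a b hab := by
    have h1 : ∀ x : A.carrier, d.rel (Quotient.out (Quotient.mk c.setoid x)) x :=
      fun x => h _ _ (Quotient.mk_out (s := c.setoid) x)
    exact d.iseqv.trans (h1 _) (d.iseqv.trans (d.compat f _ _ hab) (d.iseqv.symm (h1 _)))

theorem quot_cm {A : Alg σ} {c d : Congruence A} (h : c ≤ d) (hc : CM d d c) :
    CM (quotCong c d h) (quotCong c d h) (eqCong _) := by
  have key : ∀ p q r s, Mat (quotCong c d h).rel (quotCong c d h).rel p q r s →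
      ∃ p' q' r' s', Mat d.rel d.rel p' q' r' s' ∧ (quotHom A c).toFun p' = p ∧
        (quotHom A c).toFun q' = q ∧ (quotHom A c).toFun r' = r ∧
        (quotHom A c).toFun s' = s := by
    intro p q r s hm
    have ho : ∀ x : (quotAlg A c).carrier, (quotHom A c).toFun (Quotient.out x) = x :=
      fun x => Quotient.out_eq (s := c.setoid) x
    induction hm with
    | row a b hab =>
      exact ⟨_, _, _, _, Mat.row _ _ hab, ho _, ho _, ho _, ho _⟩
    | col a b hab =>
      exact ⟨_, _, _, _, Mat.col _ _ hab, ho _, ho _, ho _, ho _⟩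
    | op f p q r s _ ih =>
      choose p' q' r' s' hm hp hq hr hs using ih
      refine ⟨_, _, _, _, Mat.op f _ _ _ _ hm, ?_, ?_, ?_, ?_⟩ <;> rw [(quotHom A c).map_op] <;>
        refine congrArg _ (funext fun i => ?_) <;> simp only [hp, hq, hr, hs]
  intro p q r s hm hpq
  obtain ⟨p', q', r', s', hm', rfl, rfl, rfl, rfl⟩ := key p q r s hm
  exact Quotient.sound (s := c.setoid) (hc _ _ _ _ hm' (quot_exact hpq))

theorem diff_rel {V : Variety σ} {d : Trm σ (Fin 3)} (hd : IsDifferenceTrm V d) {A : Alg σ}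
    (hA : V.Mem A) {α δ : Congruence A} (hle : δ ≤ α) (hc : CM α α δ) {a b : A.carrier}
    (hab : α.rel a b) : δ.rel (ap3 A d a b b) a := by
  have hq : V.Mem (quotAlg A δ) :=
    V.closed_hom hA ⟨quotHom A δ, fun x => ⟨_, Quotient.out_eq (s := δ.setoid) x⟩⟩
  have h1 := hd.2 _ hq (quotCong δ α hle) ((isAbelian_iff _).2 (quot_cm hle hc))
    ((quotHom A δ).toFun a) ((quotHom A δ).toFun b) (by
      have h1 : ∀ x : A.carrier, α.rel (Quotient.out (Quotient.mk δ.setoid x)) x :=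
        fun x => hle _ _ (Quotient.mk_out (s := δ.setoid) x)
      exact α.iseqv.trans (h1 _) (α.iseqv.trans hab (α.iseqv.symm (h1 _))))
  apply quot_exact
  rw [hom_ap3]
  exact h1

/-- Weak stability, for `CM`. -/
def WS (V : Variety σ) : Prop :=
  ∀ A : Alg σ, V.Mem A → ∀ x y z z' : Congruence A,
    CM x y z → z ≤ z' → z' ≤ x → z' ≤ y → CM x y z'

theorem diff_imp_ws {V : Variety σ} {d : Trm σ (Fin 3)} (hd : IsDifferenceTrm V d) : WS V := by
  intro A hA x y z z' hc hz hx hy p q r s hm hpq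
  have hz' : CM z' z' z := hc.mono hx hy
  have h1 : z.rel (ap3 A d q p p) q := diff_rel hd hA hz hz' (z'.iseqv.symm hpq)
  have h2 : ap3 A d p p q = q := hd.1 A hA p q
  have h3 : ap3 A d p p s = s := hd.1 A hA p s
  have h4 : ap3 A d p p r = r := hd.1 A hA p r
  have hM : Mat x.rel y.rel (ap3 A d q p p) (ap3 A d p p q) (ap3 A d q p r) (ap3 A d p p s) :=
    Mat.ap3 d (Mat.col q p (y.iseqv.symm (hy _ _ hpq))) (Mat.row p p (x.iseqv.refl _)) hm
  have h5 : z.rel (ap3 A d q p r) (ap3 A d p p s) := by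
    refine hc _ _ _ _ hM ?_
    rw [h2]; exact h1
  rw [h3] at h5
  have h6 : z'.rel (ap3 A d p p r) (ap3 A d q p r) :=
    z'.cpt.ap3 d hpq (z'.iseqv.refl _) (z'.iseqv.refl _)
  rw [h4] at h6
  exact z'.iseqv.trans h6 (hz _ _ h5)

/-! ### Polynomials and subalgebras of squares -/

/-- Unary polynomials: terms with one variable `none` and constants `some a`. -/
def poly (A : Alg σ) (t : Trm σ (Option A.carrier)) (u : A.carrier) : A.carrier :=
  A.evalTrm (fun o => o.elim u id) t

theorem poly_upd (A : Alg σ) (t : Trm σ (Option A.carrier)) (f : σ.ops)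
    (c : Fin (σ.arity f) → A.carrier) (i : Fin (σ.arity f)) :
    ∃ t' : Trm σ (Option A.carrier), ∀ u,
      poly A t' u = poly A t (A.interp f (Function.update c i u)) := by
  refine ⟨t.sbst (fun o => o.elim
    (.op f (fun j => if j = i then .var none else .var (some (c j)))) (fun a => .var (some a))),
    fun u => ?_⟩
  unfold poly
  rw [evalTrm_sbst]
  congr 1
  funext o
  rcases o with _ | a
  · refine congrArg (A.interp f) (funext fun j => ?_)
    by_cases hj : j = i
    · subst hj
      simp [Alg.evalTrm]
    · simp [Alg.evalTrm, hj]
  · rfl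

theorem Compat.poly {A : Alg σ} {ρ : A.carrier → A.carrier → Prop} (h : Compat A ρ)
    (hr : ∀ a, ρ a a) (t : Trm σ (Option A.carrier)) {u v : A.carrier} (huv : ρ u v) :
    ρ (poly A t u) (poly A t v) := by
  refine h.eval t fun o => ?_
  rcases o with _ | a
  · exact huv
  · exact hr a

/-- The subalgebra of `A × A` on a compatible relation. -/
def relAlg (A : Alg σ) (ρ : A.carrier → A.carrier → Prop) (h : Compat A ρ) : Alg σ where
  carrier := {p : A.carrier × A.carrier // ρ p.1 p.2}
  interp f a := ⟨(A.interp f fun i => (a i).1.1, A.interp f fun i => (a i).1.2),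
    h f _ _ fun i => (a i).2⟩

/-- First projection. -/
def fstHom (A : Alg σ) (ρ : A.carrier → A.carrier → Prop) (h : Compat A ρ) :
    UAHom (relAlg A ρ h) A where
  toFun p := p.1.1
  map_op _ _ := rfl

/-- Second projection. -/
def sndHom (A : Alg σ) (ρ : A.carrier → A.carrier → Prop) (h : Compat A ρ) :
    UAHom (relAlg A ρ h) A where
  toFun p := p.1.2
  map_op _ _ := rfl

theorem relAlg_mem {V : Variety σ} {A : Alg σ} (hA : V.Mem A)
    (ρ : A.carrier → A.carrier → Prop) (h : Compat A ρ) : V.Mem (relAlg A ρ h) := by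
  refine V.closed_sub (V.closed_prod (fun _ : Bool => A) fun _ => hA)
    ⟨⟨fun p b => cond b p.1.1 p.1.2, fun f a => ?_⟩, ?_⟩
  · funext b
    cases b <;> rfl
  · intro p q hpq
    have h1 := congrFun hpq true
    have h2 := congrFun hpq false
    exact Subtype.ext (Prod.ext h1 h2)

/-- The restriction of a product congruence. -/
def prodCong {A : Alg σ} (ρ : A.carrier → A.carrier → Prop) (h : Compat A ρ)
    (c d : Congruence A) : Congruence (relAlg A ρ h) where
  rel p q := c.rel p.1.1 q.1.1 ∧ d.rel p.1.2 q.1.2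
  iseqv := ⟨fun _ => ⟨c.iseqv.refl _, d.iseqv.refl _⟩,
    fun h => ⟨c.iseqv.symm h.1, d.iseqv.symm h.2⟩,
    fun h h' => ⟨c.iseqv.trans h.1 h'.1, d.iseqv.trans h.2 h'.2⟩⟩
  compat f _ _ hab := ⟨c.compat f _ _ fun i => (hab i).1, d.compat f _ _ fun i => (hab i).2⟩

theorem prod_cm {A : Alg σ} (ρ : A.carrier → A.carrier → Prop) (h : Compat A ρ)
    {S T δ S' T' δ' : Congruence A} (hc : CM S T δ) (hc' : CM S' T' δ') :
    CM (prodCong ρ h S S') (prodCong ρ h T T') (prodCong ρ h δ δ') := by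
  intro p q r s hm hpq
  exact ⟨hc _ _ _ _ (hm.map (fstHom A ρ h) (fun _ _ h => h.1) (fun _ _ h => h.1)) hpq.1,
    hc' _ _ _ _ (hm.map (sndHom A ρ h) (fun _ _ h => h.2) (fun _ _ h => h.2)) hpq.2⟩

/-! ### Quasiorders inside abelian congruences are symmetric -/

theorem quasi_symm {V : Variety σ} (hws : WS V) {n : ℕ} {T : Trm σ (Fin n)}
    (hT : IsTaylorTrm V T) {A : Alg σ} (hA : V.Mem A) (α δ : Congruence A)
    (ρ : A.carrier → A.carrier → Prop) (hr : ∀ a, ρ a a) (ht : ∀ a b c, ρ a b → ρ b c → ρ a c)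
    (hcp : Compat A ρ) (hα : ∀ a b, ρ a b → α.rel a b)
    (hδ : ∀ a b, δ.rel a b ↔ ρ a b ∧ ρ b a) (hc : CM α α δ)
    {a b : A.carrier} (hab : ρ a b) : ρ b a := by
  classical
  obtain ⟨-, hid, htay⟩ := hT
  let R := relAlg A ρ hcp
  have hR : V.Mem R := relAlg_mem hA ρ hcp
  let α2 : Congruence R := prodCong ρ hcp α α
  let δ2 : Congruence R := prodCong ρ hcp δ δ
  have hc2 : CM α2 α2 δ2 := prod_cm ρ hcp hc hc
  have hδρ : ∀ u v, δ.rel u v → ρ u v := fun u v h => ((hδ u v).1 h).1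
  have hδα : ∀ u v, δ.rel u v → α.rel u v := fun u v h => hα _ _ (hδρ u v h)
  let D : R.carrier → Prop := fun p => ρ p.1.2 p.1.1
  have hDδ : ∀ p q, δ2.rel p q → D p → D q := by
    intro p q hpq hp
    exact ht _ _ _ (hδρ _ _ (δ.iseqv.symm hpq.2)) (ht _ _ _ hp (hδρ _ _ hpq.1))
  let ψrel : R.carrier → R.carrier → Prop := fun p q =>
    α2.rel p q ∧ ∀ t, (D (poly R t p) ↔ D (poly R t q))
  have ψrefl : ∀ p, ψrel p p := fun p => ⟨α2.iseqv.refl p, fun t => Iff.rfl⟩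
  have ψtrans : ∀ p q r, ψrel p q → ψrel q r → ψrel p r := fun p q r h h' =>
    ⟨α2.iseqv.trans h.1 h'.1, fun t => (h.2 t).trans (h'.2 t)⟩
  let ψ : Congruence R :=
    { rel := ψrel
      iseqv := ⟨ψrefl, fun h => ⟨α2.iseqv.symm h.1, fun t => (h.2 t).symm⟩,
        fun h h' => ψtrans _ _ _ h h'⟩
      compat := by
        refine compat_of_update ψrefl ψtrans ?_
        intro f c i u v huv
        refine ⟨α2.compat f _ _ fun j => ?_, fun t => ?_⟩
        · by_cases hj : j = i
          · subst hj; simpa using huv.1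
          · simpa [hj] using α2.iseqv.refl (c j)
        · obtain ⟨t', ht'⟩ := poly_upd R t f c i
          rw [← ht', ← ht']
          exact huv.2 t' }
  have hδψ : δ2 ≤ ψ := by
    intro p q hpq
    refine ⟨⟨hδα _ _ hpq.1, hδα _ _ hpq.2⟩, fun t => ?_⟩
    have := δ2.cpt.poly δ2.iseqv.refl t hpq
    exact ⟨hDδ _ _ this, hDδ _ _ (δ2.iseqv.symm this)⟩
  have hψα : ψ ≤ α2 := fun p q h => h.1
  have hcψ : CM α2 α2 ψ := hws R hR α2 α2 δ2 ψ hc2 hδψ hψα hψα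
  -- notation: `TA w` is the value of `T` at the tuple with `b` at the places where `w` holds
  let sel : Finset (Fin n) → Fin n → A.carrier := fun s j => if j ∈ s then b else a
  let TA : Finset (Fin n) → A.carrier := fun s => A.evalTrm (sel s) T
  have hαab : α.rel a b := hα _ _ hab
  have TA_empty : TA ∅ = a := by
    have : sel ∅ = fun _ => a := by funext j; simp [sel]
    show A.evalTrm (sel ∅) T = a
    rw [this]; exact hid A hA a
  have TA_univ : TA Finset.univ = b := by
    have : sel Finset.univ = fun _ => b := by funext j; simp [sel]
    show A.evalTrm (sel Finset.univ) T = b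
    rw [this]; exact hid A hA b
  have TA_mono : ∀ s s' : Finset (Fin n), s ⊆ s' → ρ (TA s) (TA s') := by
    intro s s' hs
    refine hcp.eval T fun j => ?_
    show ρ (if j ∈ s then b else a) (if j ∈ s' then b else a)
    by_cases h1 : j ∈ s
    · simp [h1, hs h1, hr]
    · by_cases h2 : j ∈ s'
      · simpa [h1, h2] using hab
      · simp [h1, h2, hr]
  have TA_mat : ∀ (i : Fin n) (s : Finset (Fin n)), i ∉ s →
      Mat α.rel α.rel (TA ∅) (TA {i}) (TA s) (TA (insert i s)) := by
    intro i s his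
    refine Mat.eval T fun j => ?_
    show Mat α.rel α.rel (if j ∈ (∅ : Finset (Fin n)) then b else a)
      (if j ∈ ({i} : Finset (Fin n)) then b else a) (if j ∈ s then b else a)
      (if j ∈ insert i s then b else a)
    by_cases hj : j = i
    · subst hj
      simpa [his] using Mat.col a b hαab
    · by_cases hs : j ∈ s
      · simpa [hj, hs] using Mat.row a b hαab
      · simpa [hj, hs] using Mat.row a a (α.iseqv.refl a)
  -- the Taylor identities
  have TA_tay : ∀ i : Fin n, ∃ s s' : Finset (Fin n), i ∈ s ∧ i ∉ s' ∧ TA s = TA s' := by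
    intro i
    obtain ⟨w, z, hwz, hid⟩ := htay i
    have e1 : ∀ (w : Fin n → Bool),
        (fun j => cond (w j) b a) = sel (Finset.univ.filter fun j => w j = true) := by
      intro w; funext j
      cases h : w j <;> simp [sel, h]
    have e2 : ∀ (w : Fin n → Bool),
        (fun j => cond (w j) a b) = sel (Finset.univ.filter fun j => w j = false) := by
      intro w; funext j
      cases h : w j <;> simp [sel, h]
    have h1 := hid A hA b a
    have h2 := hid A hA a b
    rw [e1, e1] at h1
    rw [e2, e2] at h2
    cases hw : w i <;> cases hz : z i
    · rw [hw, hz] at hwz; exact absurd rfl hwz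
    · exact ⟨_, _, by simp [hw], by simp [hz], h2⟩
    · exact ⟨_, _, by simp [hw], by simp [hz], h1⟩
    · rw [hw, hz] at hwz; exact absurd rfl hwz
  let e : R.carrier := ⟨(a, b), hab⟩
  let o : R.carrier := ⟨(a, a), hr a⟩
  let TR : Finset (Fin n) → R.carrier := fun s => R.evalTrm (fun j => if j ∈ s then e else o) T
  have TR_fst : ∀ s, (TR s).1.1 = a := by
    intro s
    have h1 := hom_eval (fstHom A ρ hcp) (fun j => if j ∈ s then e else o) T
    have h2 : (fun j => (fstHom A ρ hcp).toFun (if j ∈ s then e else o)) = fun _ => a := by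
      funext j
      by_cases h : j ∈ s <;> simp [h, fstHom, e, o]
    rw [h2, hid A hA a] at h1
    exact h1
  have TR_snd : ∀ s, (TR s).1.2 = TA s := by
    intro s
    have h1 := hom_eval (sndHom A ρ hcp) (fun j => if j ∈ s then e else o) T
    have h2 : (fun j => (sndHom A ρ hcp).toFun (if j ∈ s then e else o)) = sel s := by
      funext j
      by_cases h : j ∈ s <;> simp [h, sndHom, e, o, sel]
    rw [h2] at h1
    exact h1
  have hαoe : α2.rel o e := ⟨α.iseqv.refl a, hαab⟩
  have TR_mat : ∀ i : Fin n,
      Mat α2.rel α2.rel (TR Finset.univ) (TR (Finset.univ.erase i)) (TR {i}) (TR ∅) := by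
    intro i
    refine Mat.eval T fun j => ?_
    by_cases hj : j = i
    · subst hj
      simpa using Mat.col (S := α2.rel) e o (α2.iseqv.symm hαoe)
    · simpa [hj] using Mat.row (T := α2.rel) e o (α2.iseqv.symm hαoe)
  have TR_psi : ∀ i : Fin n, ψ.rel (TR Finset.univ) (TR (Finset.univ.erase i)) := by
    intro i
    refine ⟨⟨?_, ?_⟩, fun t => ?_⟩
    · rw [TR_fst, TR_fst]; exact α.iseqv.refl a
    · rw [TR_snd, TR_snd]
      exact α.iseqv.symm (hα _ _ (TA_mono _ _ (Finset.subset_univ _)))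
    · -- the two coordinate polynomials
      let g1 : A.carrier → A.carrier := fun u =>
        A.evalTrm (fun x : Option R.carrier => x.elim u (fun p => p.1.1)) t
      let g2 : A.carrier → A.carrier := fun u =>
        A.evalTrm (fun x : Option R.carrier => x.elim u (fun p => p.1.2)) t
      have hp1 : ∀ p : R.carrier, (poly R t p).1.1 = g1 p.1.1 := by
        intro p
        have := hom_eval (fstHom A ρ hcp) (fun x : Option R.carrier => x.elim p id) t
        refine Eq.trans this ?_
        show A.evalTrm _ t = A.evalTrm _ t
        congr 1
        funext x; cases x <;> rfl
      have hp2 : ∀ p : R.carrier, (poly R t p).1.2 = g2 p.1.2 := by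
        intro p
        have := hom_eval (sndHom A ρ hcp) (fun x : Option R.carrier => x.elim p id) t
        refine Eq.trans this ?_
        show A.evalTrm _ t = A.evalTrm _ t
        congr 1
        funext x; cases x <;> rfl
      have hDp : ∀ s, D (poly R t (TR s)) ↔ ρ (g2 (TA s)) (g1 a) := by
        intro s
        show ρ (poly R t (TR s)).1.2 (poly R t (TR s)).1.1 ↔ _
        rw [hp1, hp2, TR_fst, TR_snd]
      have hg12 : ρ (g1 a) (g2 a) := by
        refine hcp.eval t fun x => ?_
        rcases x with _ | p
        · exact hr a
        · exact p.2
      have hg2 : ∀ u v, ρ u v → ρ (g2 u) (g2 v) := by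
        intro u v huv
        refine hcp.eval t fun x => ?_
        rcases x with _ | p
        · exact huv
        · exact hr _
      have hg2m : ∀ p q r s, Mat α.rel α.rel p q r s →
          Mat α.rel α.rel (g2 p) (g2 q) (g2 r) (g2 s) := by
        intro p q r s hm
        refine Mat.eval t fun x => ?_
        rcases x with _ | p
        · exact hm
        · exact Mat.row _ _ (α.iseqv.refl _)
      rw [hDp, hDp]
      constructor
      · intro h
        exact ht _ _ _ (hg2 _ _ (TA_mono _ _ (Finset.subset_univ _))) h
      · intro h
        have h0 : ρ (g2 a) (g1 a) := by
          refine ht _ _ _ (hg2 _ _ ?_) h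
          have := TA_mono ∅ (Finset.univ.erase i) (Finset.empty_subset _)
          rwa [TA_empty] at this
        have hZ : ρ (g2 (TA (Finset.univ.erase i))) (g2 a) := ht _ _ _ h hg12
        obtain ⟨s, s', his, his', hss⟩ := TA_tay i
        have h1 : ρ (g2 (TA s')) (g2 a) := by
          refine ht _ _ _ (hg2 _ _ (TA_mono _ _ ?_)) hZ
          intro j hj
          simp only [Finset.mem_erase, Finset.mem_univ, and_true]
          rintro rfl
          exact his' hj
        rw [← hss] at h1
        have h2 : ρ (g2 (TA {i})) (g2 a) :=
          ht _ _ _ (hg2 _ _ (TA_mono _ _ (by simpa using his))) h1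
        have h3 : δ.rel (g2 (TA ∅)) (g2 (TA {i})) := by
          rw [hδ]
          refine ⟨hg2 _ _ (TA_mono _ _ (Finset.empty_subset _)), ?_⟩
          rw [TA_empty]; exact h2
        have h4 := hc _ _ _ _ (hg2m _ _ _ _ (TA_mat i (Finset.univ.erase i) (by simp))) h3
        rw [Finset.insert_erase (Finset.mem_univ i)] at h4
        exact ht _ _ _ (hδρ _ _ (δ.iseqv.symm h4)) h
  have hsingle : ∀ i : Fin n, δ.rel (TA ∅) (TA {i}) := by
    intro i
    have h1 := hcψ _ _ _ _ (TR_mat i) (TR_psi i)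
    have h2 := h1.2 (.var none)
    have h3 : D (TR ∅) := by
      show ρ (TR ∅).1.2 (TR ∅).1.1
      rw [TR_fst, TR_snd, TA_empty]; exact hr a
    have h4 : D (TR {i}) := h2.2 h3
    have h5 : ρ (TR {i}).1.2 (TR {i}).1.1 := h4
    rw [TR_fst, TR_snd] at h5
    rw [hδ]
    refine ⟨TA_mono _ _ (Finset.empty_subset _), ?_⟩
    rw [TA_empty]; exact h5
  have hall : ∀ s : Finset (Fin n), δ.rel (TA ∅) (TA s) := by
    intro s
    induction s using Finset.induction_on with
    | empty => exact δ.iseqv.refl _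
    | insert i s hi ih =>
      exact δ.iseqv.trans ih (hc _ _ _ _ (TA_mat i s hi) (hsingle i))
  have := hall Finset.univ
  rw [TA_empty, TA_univ, hδ] at this
  exact this.2

/-! ### Free algebras on two generators -/

/-- Equality of terms throughout a variety. -/
def idSetoid (V : Variety σ) (X : Type) : Setoid (Trm σ X) where
  r t s := ∀ A : Alg σ, V.Mem A → ∀ asg : X → A.carrier, A.evalTrm asg t = A.evalTrm asg s
  iseqv := ⟨fun _ _ _ _ => rfl, fun h A hA asg => (h A hA asg).symm,
    fun h h' A hA asg => (h A hA asg).trans (h' A hA asg)⟩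

/-- The free algebra. -/
noncomputable def freeAlg (V : Variety σ) (X : Type) : Alg σ where
  carrier := Quotient (idSetoid V X)
  interp f a := Quotient.mk (idSetoid V X) (.op f fun i => (a i).out)

theorem freeAlg_interp (V : Variety σ) (X : Type) (f : σ.ops)
    (ts : Fin (σ.arity f) → Trm σ X) :
    (freeAlg V X).interp f (fun i => Quotient.mk (idSetoid V X) (ts i))
      = Quotient.mk (idSetoid V X) (.op f ts) := by
  refine Quotient.sound (s := idSetoid V X) fun A hA asg => ?_
  refine congrArg (A.interp f) (funext fun i => ?_)
  exact Quotient.mk_out (s := idSetoid V X) (ts i) A hA asg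

/-- Evaluation out of the free algebra. -/
noncomputable def freeHom (V : Variety σ) (X : Type) {A : Alg σ} (hA : V.Mem A)
    (asg : X → A.carrier) : UAHom (freeAlg V X) A where
  toFun := Quotient.lift (s := idSetoid V X) (fun t => A.evalTrm asg t) fun _ _ h => h A hA asg
  map_op f a := by
    refine congrArg (A.interp f) (funext fun i => ?_)
    conv_rhs => rw [← Quotient.out_eq (s := idSetoid V X) (a i)]
    rfl

theorem freeAlg_mem (V : Variety σ) (X : Type) : V.Mem (freeAlg V X) := by
  have key : ∀ i : Trm σ X × Trm σ X, ∃ (A : Alg σ) (asg : X → A.carrier), V.Mem A ∧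
      (A.evalTrm asg i.1 = A.evalTrm asg i.2 → (idSetoid V X).r i.1 i.2) := by
    intro i
    by_cases h : (idSetoid V X).r i.1 i.2
    · exact ⟨prodAlg (fun e : Empty => e.elim), fun _ e => e.elim,
        V.closed_prod _ fun e => e.elim, fun _ => h⟩
    · have h' : ¬ ∀ A : Alg σ, V.Mem A → ∀ asg : X → A.carrier,
          A.evalTrm asg i.1 = A.evalTrm asg i.2 := h
      push Not at h'
      obtain ⟨A, hA, asg, hne⟩ := h'
      exact ⟨A, asg, hA, fun he => absurd he hne⟩
  choose G asg hG hsep using key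
  refine V.closed_sub (V.closed_prod G hG)
    ⟨⟨fun p i => (freeHom V X (hG i) (asg i)).toFun p, fun f a => ?_⟩, ?_⟩
  · funext i
    exact (freeHom V X (hG i) (asg i)).map_op f a
  · intro p q hpq
    induction p using Quotient.inductionOn with
    | _ t =>
    induction q using Quotient.inductionOn with
    | _ s =>
    exact Quotient.sound (s := idSetoid V X) (hsep (t, s) (congrFun hpq (t, s)))

/-- Evaluation of a binary term. -/
def ev (A : Alg σ) (a b : A.carrier) (t : Trm σ Bool) : A.carrier :=
  A.evalTrm (fun v => cond v a b) t

theorem exists_free (V : Variety σ) :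
    ∃ (F : Alg σ) (x y : F.carrier), V.Mem F ∧ (∀ f, ∃ t : Trm σ Bool, f = ev F x y t) ∧
      (∀ A : Alg σ, V.Mem A → ∀ a b : A.carrier,
        ∃ h : UAHom F A, h.toFun x = a ∧ h.toFun y = b) := by
  refine ⟨freeAlg V Bool, Quotient.mk (idSetoid V Bool) (.var true),
    Quotient.mk (idSetoid V Bool) (.var false), freeAlg_mem V Bool, fun f => ?_, ?_⟩
  · induction f using Quotient.inductionOn with
    | _ t =>
    refine ⟨t, ?_⟩
    induction t with
    | var v => cases v <;> rfl
    | op f ts ih =>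
      rw [← freeAlg_interp]
      exact congrArg _ (funext ih)
  · intro A hA a b
    exact ⟨freeHom V Bool hA (fun v => cond v a b), rfl, rfl⟩

/-- Transfer of relations modulo the commutator of the principal congruence. -/
theorem transfer {F A : Alg σ} {x y : F.carrier} (h : UAHom F A) {α δ : Congruence A}
    (hc : CM α α δ) (hxy : α.rel (h.toFun x) (h.toFun y)) {f g : F.carrier}
    (hfg : (commC (cgPair F x y) (cgPair F x y)).rel f g) :
    δ.rel (h.toFun f) (h.toFun g) := by
  let pb : Congruence A → Congruence F := fun c =>
    { rel := fun u v => c.rel (h.toFun u) (h.toFun v)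
      iseqv := ⟨fun _ => c.iseqv.refl _, fun h => c.iseqv.symm h, fun h h' => c.iseqv.trans h h'⟩
      compat := fun f a b hab => by
        rw [h.map_op, h.map_op]
        exact c.compat f _ _ hab }
  have h1 : CM (pb α) (pb α) (pb δ) := fun p q r s hm hpq =>
    hc _ _ _ _ (hm.map h (fun _ _ h => h) (fun _ _ h => h)) hpq
  have h2 : cgPair F x y ≤ pb α := fun u v huv => huv (pb α) hxy
  exact commC_le (h1.mono h2 h2) f g hfg

/-! ### A weak difference term -/

/-- A term that is a weak difference term relative to centralizing congruences. -/
def IsWD (V : Variety σ) (w : Trm σ (Fin 3)) : Prop :=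
  ∀ A : Alg σ, V.Mem A → ∀ α δ : Congruence A, CM α α δ → ∀ a b, α.rel a b →
    δ.rel (ap3 A w a a b) b ∧ δ.rel (ap3 A w a b b) a

theorem half_inv {A : Alg σ} {α δ : Congruence A} (hle : δ ≤ α) (hc : CM α α δ)
    {p : Trm σ (Fin 3)}
    (hp : ∀ a b, α.rel a b → δ.rel (ap3 A p a a b) b) {u v z : A.carrier}
    (huv : α.rel u v) (huz : α.rel u z) : δ.rel (ap3 A p u v (ap3 A p v u z)) z := by
  have r := α.iseqv.refl
  have dr := δ.iseqv.refl
  have hvu := α.iseqv.symm huv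
  have hvz := α.iseqv.trans hvu huz
  have hm := Mat.ap3 p (Mat.row (T := α.rel) u u (r u)) (Mat.col (S := α.rel) v u hvu)
    (Mat.ap3 p (Mat.col v u hvu) (Mat.row v u hvu) (Mat.row z z (r z)))
  have hidem : α.rel u (ap3 A p u u u) := α.iseqv.symm (hle _ _ (hp u u (r u)))
  have hu3 : α.rel u (ap3 A p u v z) := α.iseqv.trans hidem (α.cpt.ap3 p (r u) huv huz)
  have hu4 : α.rel u (ap3 A p u u z) := α.iseqv.trans hidem (α.cpt.ap3 p (r u) (r u) huz)
  have h1 : δ.rel (ap3 A p u v (ap3 A p v v z)) (ap3 A p u v z) :=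
    δ.cpt.ap3 p (dr _) (dr _) (hp _ _ hvz)
  have h2 : δ.rel (ap3 A p u u (ap3 A p u v z)) (ap3 A p u v z) := hp _ _ hu3
  have h3 := hc _ _ _ _ hm (δ.iseqv.trans h1 (δ.iseqv.symm h2))
  refine δ.iseqv.trans h3 ?_
  exact δ.iseqv.trans (hp _ _ hu4) (hp _ _ huz)

theorem exists_wd {V : Variety σ} (hws : WS V) {n : ℕ} {T : Trm σ (Fin n)}
    (hT : IsTaylorTrm V T) : ∃ w, IsWD V w := by
  obtain ⟨F, x, y, hF, hgen, hfree⟩ := exists_free V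
  let θ := cgPair F x y
  let N := commC θ θ
  have hcN : CM θ θ N := CM.comm θ θ
  have hNθ : N ≤ θ := commC_le (CM.self θ θ)
  have hxy : θ.rel x y := fun c hc => hc
  have hyx := θ.iseqv.symm hxy
  have Nr := N.iseqv.refl
  let R : F.carrier → F.carrier → Prop := fun a b => ∃ p : Trm σ (Fin 3),
    N.rel a (ap3 F p x x y) ∧ N.rel b (ap3 F p x y y)
  have Rrefl : ∀ a, R a a := by
    intro a
    obtain ⟨t, rfl⟩ := hgen a
    have key : ∀ u, ap3 F (t.sbst (fun v => .var (cond v 0 2))) x u y = ev F x y t := by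
      intro u
      unfold ap3 ev
      rw [evalTrm_sbst]
      congr 1
      funext v
      cases v <;> rfl
    refine ⟨t.sbst (fun v => .var (cond v 0 2)), ?_, ?_⟩
    · rw [key]; exact Nr _
    · rw [key]; exact Nr _
  have Rcp : Compat F R := by
    intro f a b hab
    choose p hp hq using hab
    exact ⟨.op f p, N.compat f _ _ hp, N.compat f _ _ hq⟩
  have RN : ∀ a b c, R a b → N.rel b c → R a c := fun a b c ⟨p, h1, h2⟩ h =>
    ⟨p, h1, N.iseqv.trans (N.iseqv.symm h) h2⟩
  have Rθ : ∀ a b, R a b → θ.rel a b := fun a b ⟨p, h1, h2⟩ =>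
    θ.iseqv.trans (hNθ _ _ h1) (θ.iseqv.trans
      (θ.cpt.ap3 p (θ.iseqv.refl _) hxy (θ.iseqv.refl _)) (θ.iseqv.symm (hNθ _ _ h2)))
  have Rxy : R x y := ⟨.var 1, Nr _, Nr _⟩
  have Rtr : ∀ c d, R y c → R c d → R y d := by
    intro c d h1 h2
    have hyd := θ.iseqv.trans (Rθ _ _ h1) (Rθ _ _ h2)
    obtain ⟨p1, h1, h1'⟩ := h1
    obtain ⟨p2, h2, h2'⟩ := h2
    have hp : ∀ a b, θ.rel a b → N.rel (ap3 F p1 a a b) b := by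
      intro a b hab
      obtain ⟨h, ha, hb⟩ := hfree F hF a b
      have := transfer h hcN (by rw [ha, hb]; exact hab) (N.iseqv.symm h1)
      rwa [hom_ap3, ha, hb] at this
    have key : ∀ u, ap3 F (sb3 p1 (.var 0) (.var 1)
        (sb3 p1 (.var 2) (.var 0) p2)) x u y
          = ap3 F p1 x u (ap3 F p1 y x (ap3 F p2 x u y)) := by
      intro u
      conv_lhs => unfold ap3
      rw [eval_sb3, eval_sb3]
      rfl
    refine ⟨sb3 p1 (.var 0) (.var 1) (sb3 p1 (.var 2) (.var 0) p2), ?_, ?_⟩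
    · rw [key]
      have e1 : N.rel (ap3 F p1 y x (ap3 F p2 x x y)) y := by
        refine N.iseqv.trans (N.cpt.ap3 p1 (Nr _) (Nr _)
          (N.iseqv.trans (N.iseqv.symm h2) h1')) ?_
        exact half_inv hNθ hcN hp hyx (θ.iseqv.refl _)
      refine N.iseqv.symm (N.iseqv.trans (N.cpt.ap3 p1 (Nr _) (Nr _) e1) (hp _ _ hxy))
    · rw [key]
      refine N.iseqv.symm (N.iseqv.trans (N.cpt.ap3 p1 (Nr _) (Nr _)
        (N.cpt.ap3 p1 (Nr _) (Nr _) (N.iseqv.symm h2'))) ?_)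
      exact half_inv hNθ hcN hp hxy (θ.iseqv.trans hxy hyd)
  let ρ : F.carrier → F.carrier → Prop := fun a b =>
    θ.rel a b ∧ ∀ t, R y (poly F t a) → R y (poly F t b)
  have ρrefl : ∀ a, ρ a a := fun a => ⟨θ.iseqv.refl a, fun _ h => h⟩
  have ρtrans : ∀ a b c, ρ a b → ρ b c → ρ a c := fun a b c h h' =>
    ⟨θ.iseqv.trans h.1 h'.1, fun t ht => h'.2 t (h.2 t ht)⟩
  have ρcp : Compat F ρ := by
    refine compat_of_update ρrefl ρtrans ?_
    intro f c i u v huv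
    refine ⟨θ.compat f _ _ fun j => ?_, fun t => ?_⟩
    · by_cases hj : j = i
      · subst hj; simpa using huv.1
      · simpa [hj] using θ.iseqv.refl (c j)
    · obtain ⟨t', ht'⟩ := poly_upd F t f c i
      rw [← ht', ← ht']
      exact huv.2 t'
  let δ : Congruence F :=
    { rel := fun a b => ρ a b ∧ ρ b a
      iseqv := ⟨fun a => ⟨ρrefl a, ρrefl a⟩, fun h => ⟨h.2, h.1⟩,
        fun h h' => ⟨ρtrans _ _ _ h.1 h'.1, ρtrans _ _ _ h'.2 h.2⟩⟩
      compat := fun f a b hab => ⟨ρcp f a b fun i => (hab i).1, ρcp f b a fun i => (hab i).2⟩ }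
  have Nρ : ∀ a b, N.rel a b → ρ a b := fun a b hab =>
    ⟨hNθ _ _ hab, fun t ht => RN _ _ _ ht (N.cpt.poly Nr t hab)⟩
  have hcδ : CM θ θ δ := by
    have hle : δ ≤ θ := fun a b h => h.1.1
    exact hws F hF θ θ N δ hcN (fun a b h => ⟨Nρ _ _ h, Nρ _ _ (N.iseqv.symm h)⟩) hle hle
  have ρxy : ρ x y := ⟨hxy, fun t ht => Rtr _ _ ht (Rcp.poly Rrefl t Rxy)⟩
  have ρyx : ρ y x := quasi_symm hws hT hF θ δ ρ ρrefl ρtrans ρcp (fun _ _ h => h.1)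
    (fun _ _ => Iff.rfl) hcδ ρxy
  obtain ⟨w, hw1, hw2⟩ : R y x := ρyx.2 (.var none) (Rrefl y)
  refine ⟨w, fun A hA α δ hc a b hab => ?_⟩
  obtain ⟨h, ha, hb⟩ := hfree A hA a b
  have e1 := transfer h hc (by rw [ha, hb]; exact hab) (N.iseqv.symm hw1)
  have e2 := transfer h hc (by rw [ha, hb]; exact hab) (N.iseqv.symm hw2)
  rw [hom_ap3, ha, hb] at e1 e2
  exact ⟨e1, e2⟩

/-! ### From a weak difference term to a difference term -/

theorem IsWD.idem {V : Variety σ} {w : Trm σ (Fin 3)} (hw : IsWD V w) {A : Alg σ}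
    (hA : V.Mem A) (a : A.carrier) : ap3 A w a a a = a :=
  (hw A hA (eqCong A) (eqCong A) (CM.self _ _) a a rfl).1

theorem exists_quat {V : Variety σ} (hws : WS V) {w : Trm σ (Fin 3)} (hw : IsWD V w) :
    ∃ s : Trm σ (Fin 4), (∀ A : Alg σ, V.Mem A → ∀ a b, ap4 A s (ap3 A w a a b) a a b = a) ∧
      ∀ A : Alg σ, V.Mem A → ∀ α δ : Congruence A, CM α α δ → ∀ a b, α.rel a b →
        δ.rel (ap4 A s (ap3 A w a a b) a b b) a ∧
        δ.rel (ap4 A s (ap3 A w a b b) a b b) (ap3 A w a b a) := by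
  obtain ⟨F, x, y, hF, hgen, hfree⟩ := exists_free V
  let θ := cgPair F x y
  let N := commC θ θ
  have hcN : CM θ θ N := CM.comm θ θ
  have hNθ : N ≤ θ := commC_le (CM.self θ θ)
  have hxy : θ.rel x y := fun c hc => hc
  have hyx := θ.iseqv.symm hxy
  let τ : F.carrier → F.carrier → Prop := fun f g => ∃ t : Trm σ (Fin 3),
    f = ap3 F t x x y ∧ g = ap3 F t x y y
  have τcp : Compat F τ := by
    intro f a b hab
    choose p hp hq using hab
    exact ⟨.op f p, congrArg _ (funext hp), congrArg _ (funext hq)⟩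
  let B := relAlg F τ τcp
  have hB : V.Mem B := relAlg_mem hF τ τcp
  let X : B.carrier := ⟨(x, x), .var 0, rfl, rfl⟩
  let Z : B.carrier := ⟨(x, y), .var 1, rfl, rfl⟩
  let Y : B.carrier := ⟨(y, y), .var 2, rfl, rfl⟩
  have f3 : ∀ (t : Trm σ (Fin 3)) (a b c : B.carrier),
      (ap3 B t a b c).1.1 = ap3 F t a.1.1 b.1.1 c.1.1 := hom_ap3 (fstHom F τ τcp)
  have s3 : ∀ (t : Trm σ (Fin 3)) (a b c : B.carrier),
      (ap3 B t a b c).1.2 = ap3 F t a.1.2 b.1.2 c.1.2 := hom_ap3 (sndHom F τ τcp)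
  have f4 : ∀ (t : Trm σ (Fin 4)) (a b c d : B.carrier),
      (ap4 B t a b c d).1.1 = ap4 F t a.1.1 b.1.1 c.1.1 d.1.1 := hom_ap4 (fstHom F τ τcp)
  have s4 : ∀ (t : Trm σ (Fin 4)) (a b c d : B.carrier),
      (ap4 B t a b c d).1.2 = ap4 F t a.1.2 b.1.2 c.1.2 d.1.2 := hom_ap4 (sndHom F τ τcp)
  have gen : ∀ p : B.carrier, ∃ t : Trm σ (Fin 3), p = ap3 B t X Z Y := by
    rintro ⟨⟨f, g⟩, t, h1, h2⟩
    refine ⟨t, Subtype.ext (Prod.ext ?_ ?_)⟩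
    · rw [f3]; exact h1
    · rw [s3]; exact h2
  let η : Congruence B := prodCong τ τcp (eqCong F) θ
  let ζ : Congruence B := prodCong τ τcp θ θ
  let z0 : Congruence B := prodCong τ τcp (eqCong F) N
  have hc : CM ζ η z0 := prod_cm τ τcp (CM.self θ (eqCong F)) hcN
  have hηζ : η ≤ ζ := fun p q h => ⟨by
    have h1 : p.1.1 = q.1.1 := h.1
    rw [h1]; exact θ.iseqv.refl _, h.2⟩
  have hzη : z0 ≤ η := fun p q h => ⟨h.1, hNθ _ _ h.2⟩
  have hcη : CM η η z0 := hc.mono hηζ le_rfl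
  have hXZ : η.rel X Z := ⟨rfl, hxy⟩
  have zr := z0.iseqv.refl
  let E1 := ap3 B w X X Y
  let E2 := ap3 B w X Z Y
  have hE : η.rel E1 E2 := η.cpt.ap3 w (η.iseqv.refl _) hXZ (η.iseqv.refl _)
  let K : B.carrier → B.carrier → Prop := fun p q => ∃ s : Trm σ (Fin 4),
    z0.rel p (ap4 B s E1 X Z Y) ∧ z0.rel q (ap4 B s E2 X Z Y)
  have Krefl : ∀ p, K p p := by
    intro p
    obtain ⟨t, rfl⟩ := gen p
    have key : ∀ u, ap4 B (sb3 t (.var 1) (.var 2) (.var 3)) u X Z Y = ap3 B t X Z Y := by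
      intro u
      unfold ap4
      rw [eval_sb3]
      rfl
    refine ⟨sb3 t (.var 1) (.var 2) (.var 3), ?_, ?_⟩
    · rw [key]; exact zr _
    · rw [key]; exact zr _
  have Kcp : Compat B K := by
    intro f a b hab
    choose p hp hq using hab
    exact ⟨.op f p, z0.compat f _ _ hp, z0.compat f _ _ hq⟩
  have Kz : ∀ p q p' q', K p q → z0.rel p p' → z0.rel q q' → K p' q' :=
    fun p q p' q' ⟨s, h1, h2⟩ hp hq =>
      ⟨s, z0.iseqv.trans (z0.iseqv.symm hp) h1, z0.iseqv.trans (z0.iseqv.symm hq) h2⟩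
  have Kη : ∀ p q, K p q → η.rel p q := fun p q ⟨s, h1, h2⟩ =>
    η.iseqv.trans (hzη _ _ h1) (η.iseqv.trans
      (η.cpt.ap4 s hE (η.iseqv.refl _) (η.iseqv.refl _) (η.iseqv.refl _))
      (η.iseqv.symm (hzη _ _ h2)))
  have wz := hw B hB η z0 hcη
  have Ksymm : ∀ p q, K p q → K q p := by
    intro p q h
    have h1 := Kcp.ap3 w (Krefl p) h (Krefl q)
    exact Kz _ _ _ _ h1 (wz _ _ (Kη _ _ h)).1 (wz _ _ (Kη _ _ h)).2
  have Ktrans : ∀ p q r, K p q → K q r → K p r := by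
    intro p q r h h'
    have h1 := Kcp.ap3 w h (Krefl q) h'
    exact Kz _ _ _ _ h1 (wz _ _ (Kη _ _ h)).2 (wz _ _ (Kη _ _ h')).1
  let z1 : Congruence B :=
    { rel := K
      iseqv := ⟨Krefl, fun h => Ksymm _ _ h, fun h h' => Ktrans _ _ _ h h'⟩
      compat := Kcp }
  have hz1η : z1 ≤ η := Kη
  have hc1 : CM ζ η z1 := hws B hB ζ η z0 z1 hc
    (fun p q h => Kz _ _ _ _ (Krefl p) (zr _) h) (le_trans hz1η hηζ) hz1η
  have hm : Mat ζ.rel η.rel (ap3 B w X X Y) (ap3 B w X Z Y) (ap3 B w X X X) (ap3 B w X Z X) :=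
    Mat.ap3 w (Mat.row X X (ζ.iseqv.refl _)) (Mat.col X Z hXZ) (Mat.row Y X ⟨hyx, hyx⟩)
  obtain ⟨s, h1, h2⟩ : K (ap3 B w X X X) (ap3 B w X Z X) := hc1 _ _ _ _ hm ⟨.var 0, zr _, zr _⟩
  have g1 : ap3 F w x x x = ap4 F s (ap3 F w x x y) x x y := by
    have := h1.1
    rw [f3, f4, f3] at this
    exact this
  have g2 : N.rel (ap3 F w x x x) (ap4 F s (ap3 F w x x y) x y y) := by
    have := h1.2
    rw [s3, s4, s3] at this
    exact this
  have g3 : N.rel (ap3 F w x y x) (ap4 F s (ap3 F w x y y) x y y) := by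
    have := h2.2
    rw [s3, s4, s3] at this
    exact this
  rw [hw.idem hF] at g1 g2
  refine ⟨s, fun A hA a b => ?_, fun A hA α δ hc a b hab => ?_⟩
  · obtain ⟨h, ha, hb⟩ := hfree A hA a b
    have := congrArg h.toFun g1
    rw [hom_ap4, hom_ap3, ha, hb] at this
    exact this.symm
  · obtain ⟨h, ha, hb⟩ := hfree A hA a b
    have e1 := transfer h hc (by rw [ha, hb]; exact hab) (N.iseqv.symm g2)
    have e2 := transfer h hc (by rw [ha, hb]; exact hab) (N.iseqv.symm g3)
    rw [hom_ap4, hom_ap3, ha, hb] at e1 e2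
    rw [hom_ap3, ha, hb] at e2
    exact ⟨e1, e2⟩

theorem quat_solve {A : Alg σ} {α : Congruence A} (hc : CM α α (eqCong A)) {w : Trm σ (Fin 3)}
    {s : Trm σ (Fin 4)}
    (w1 : ∀ a b, α.rel a b → ap3 A w a a b = b) (w2 : ∀ a b, α.rel a b → ap3 A w a b b = a)
    (s1 : ∀ a b, α.rel a b → ap4 A s b a a b = a)
    (s2 : ∀ a b, α.rel a b → ap4 A s b a b b = a)
    (s3 : ∀ a b, α.rel a b → ap4 A s a a b b = ap3 A w a b a)
    {x y : A.carrier} (hxy : α.rel x y) : ap4 A s (ap3 A w x y x) y y x = x := by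
  have r := α.iseqv.refl
  have hyx := α.iseqv.symm hxy
  have hwα : ∀ a b c, α.rel x a → α.rel x b → α.rel x c → α.rel x (ap3 A w a b c) := by
    intro a b c ha hb hc
    have := α.cpt.ap3 w ha hb hc
    rwa [w1 x x (r x)] at this
  have hsα : ∀ a b c d, α.rel x a → α.rel x b → α.rel x c → α.rel x d →
      α.rel x (ap4 A s a b c d) := by
    intro a b c d ha hb hc hd
    have := α.cpt.ap4 s ha hb hc hd
    rwa [s1 x x (r x)] at this
  have hwe : α.rel x (ap3 A w x y x) := hwα _ _ _ (r x) hxy (r x)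
  have ff : ∀ u a b c, α.rel x u → α.rel x a → α.rel x b → α.rel x c →
      ap3 A w (ap4 A s u a b c) (ap4 A s u a b c) u = u := fun u a b c hu ha hb hc =>
    w1 _ _ (α.iseqv.trans (α.iseqv.symm (hsα _ _ _ _ hu ha hb hc)) hu)
  have m1 := Mat.ap3 w (Mat.ap3 w (Mat.row (S := α.rel) (T := α.rel) x x (r x))
    (Mat.col x y hxy) (Mat.row y x hyx)) (Mat.row y x hyx) (Mat.col x y hxy)
  have t1 : ap3 A w (ap3 A w x y x) x y = x := by
    have h := hc _ _ _ _ m1 (by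
      show _ = _
      rw [w1 x y hxy, w1 y x hyx, w2 x y hxy, w2 x y hxy])
    have h' : ap3 A w (ap3 A w x x x) x x = ap3 A w (ap3 A w x y x) x y := h
    rw [w1 x x (r x), w1 x x (r x)] at h'
    exact h'.symm
  have rx : Mat α.rel α.rel x x x x := Mat.row x x (r x)
  have ry : Mat α.rel α.rel y y y y := Mat.row y y (r y)
  have m2 := Mat.ap3 w (Mat.ap4 s rx (Mat.row x y hxy) ry (Mat.row y x hyx))
    (Mat.ap4 s (Mat.col x y hxy) (Mat.row x y hxy) ry (Mat.row y x hyx)) (Mat.col x y hxy)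
  have t2 : ap3 A w (ap4 A s x y y x) (ap4 A s y y y x) y = x := by
    have h := hc _ _ _ _ m2 (by
      show _ = _
      rw [ff x x y y (r x) (r x) hxy hxy, s3 x y hxy, s2 x y hxy, t1])
    have h' : ap3 A w (ap4 A s x y y x) (ap4 A s x y y x) x
      = ap3 A w (ap4 A s x y y x) (ap4 A s y y y x) y := h
    rw [ff x y y x (r x) hxy hxy (r x)] at h'
    exact h'.symm
  have mi := Mat.ap3 w rx (Mat.col x y hxy) (Mat.row y x hyx)
  have m3 := Mat.ap3 w (Mat.ap4 s (Mat.ap3 w rx ry (Mat.row y x hyx)) ry ry rx)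
    (Mat.ap4 s mi ry ry rx) mi
  have t3 : ap3 A w (ap4 A s (ap3 A w x y x) y y x) y x = ap3 A w x y x := by
    have h := hc _ _ _ _ m3 (by
      show _ = _
      rw [w1 x y hxy, w2 x y hxy, t2, ff x y y x (r x) hxy hxy (r x)])
    have h' : ap3 A w (ap4 A s (ap3 A w x y x) y y x) (ap4 A s (ap3 A w x x x) y y x)
        (ap3 A w x x x)
      = ap3 A w (ap4 A s (ap3 A w x y x) y y x) (ap4 A s (ap3 A w x y x) y y x)
        (ap3 A w x y x) := h
    rw [w1 x x (r x), s1 y x hyx, ff _ y y x hwe hxy hxy (r x)] at h'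
    exact h'
  have hS : α.rel x (ap4 A s (ap3 A w x y x) y y x) := hsα _ _ _ _ hwe hxy hxy (r x)
  have m4 := Mat.ap3 w (Mat.col (S := α.rel) _ _ (α.iseqv.symm hS)) ry (Mat.row x y hxy)
  have h := hc _ _ _ _ m4 t3
  have h' : ap3 A w (ap4 A s (ap3 A w x y x) y y x) y y = ap3 A w x y y := h
  rwa [w2 _ _ (α.iseqv.trans (α.iseqv.symm hS) hxy), w2 x y hxy] at h'

theorem exists_diff {V : Variety σ} (hws : WS V) {n : ℕ} {T : Trm σ (Fin n)}
    (hT : IsTaylorTrm V T) : ∃ d, IsDifferenceTrm V d := by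
  obtain ⟨w, hw⟩ := exists_wd hws hT
  obtain ⟨s, hs1, hs2⟩ := exists_quat hws hw
  let G : Trm σ (Fin 3) := sb3 w (.var 2) (.var 2) (.var 0)
  let H : Trm σ (Fin 3) := sb3 w G (sb3 w (.var 2) (.var 2) (.var 1)) G
  have key : ∀ (A : Alg σ) (a b c : A.carrier),
      A.evalTrm ![a, b, c] (sb4 s H (.var 2) (.var 2) (.var 0))
        = ap4 A s (ap3 A w (ap3 A w c c a) (ap3 A w c c b) (ap3 A w c c a)) c c a := by
    intro A a b c
    rw [eval_sb4, eval_sb3, eval_sb3, eval_sb3]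
    rfl
  refine ⟨sb4 s H (.var 2) (.var 2) (.var 0), fun A hA a b => ?_, fun A hA α hα a b hab => ?_⟩
  · rw [key, hw.idem hA]
    exact hs1 A hA b a
  · have hc := (isAbelian_iff α).1 hα
    have w1 : ∀ a b, α.rel a b → ap3 A w a a b = b := fun a b h => (hw A hA α _ hc a b h).1
    have w2 : ∀ a b, α.rel a b → ap3 A w a b b = a := fun a b h => (hw A hA α _ hc a b h).2
    have hba := α.iseqv.symm hab
    rw [key, w1 b a hba, w1 b b (α.iseqv.refl b)]
    refine quat_solve hc w1 w2 (fun a b h => ?_) (fun a b h => ?_) (fun a b h => ?_) hab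
    · have := hs1 A hA a b
      rwa [w1 a b h] at this
    · have h1 : _ = _ := (hs2 A hA α _ hc a b h).1
      rwa [w1 a b h] at h1
    · have h1 : _ = _ := (hs2 A hA α _ hc a b h).2
      rwa [w2 a b h] at h1

end Aux

/-- For a variety `V` with a Taylor term: `V` has a difference term iff the
centralizer relation is weakly stable under lifting in its third place
throughout `V`. -/
theorem difference_iff_weakly_stable {σ : Sig} (V : Variety σ)
    (hT : HasTaylorTrm V) :
    (∃ d : Trm σ (Fin 3), IsDifferenceTrm V d) ↔
      (∀ A : Alg σ, V.Mem A → ∀ x y z z' : Congruence A,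
        Centralizes x y z → z ≤ z' → z' ≤ x ⊓ y → Centralizes x y z') := by
  constructor
  · rintro ⟨d, hd⟩ A hA x y z z' hc hz hz'
    exact (centralizes_iff _ _ _).2 (diff_imp_ws hd A hA x y z z' ((centralizes_iff _ _ _).1 hc)
      hz (le_trans hz' inf_le_left) (le_trans hz' inf_le_right))
  · intro h
    obtain ⟨n, T, hT⟩ := hT
    refine exists_diff (fun A hA x y z z' hc hz hx hy => ?_) hT
    exact (centralizes_iff _ _ _).1 (h A hA x y z z' ((centralizes_iff _ _ _).2 hc) hz
      (le_inf hx hy))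
end

section
/- Let V be a variety that has a Taylor term and let A be a member of V. Given any pentagon sublattice {0', β, δ, θ, α} of Con(A) (with δ < θ, β ∧ θ = β ∧ δ = 0', β ∨ δ = β ∨ θ = α), the equality [α,x]_δ = x holds for every congruence x in the interval I[δ,θ]; equivalently, if δ ≤ y < x ≤ θ, then C(α,x;y) fails. -/
namespace PentAux

variable {σ : Sig} {A : Alg σ}

/-- Renaming of variables in a term. -/
def ren {V W : Type} (g : V → W) : Trm σ V → Trm σ W
  | .var v => .var (g v)
  | .op f ts => .op f fun i => ren g (ts i)

theorem eval_ren {V W : Type} (g : V → W) (asg : W → A.carrier) (t : Trm σ V) :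
    A.evalTrm asg (ren g t) = A.evalTrm (fun v => asg (g v)) t := by
  induction t with
  | var v => rfl
  | op f ts ih =>
    simp only [ren, Alg.evalTrm]
    congr 1
    funext i
    exact ih i

theorem eval_compat (R : A.carrier → A.carrier → Prop)
    (hR : ∀ (f : σ.ops) (a b : Fin (σ.arity f) → A.carrier),
      (∀ i, R (a i) (b i)) → R (A.interp f a) (A.interp f b))
    {V : Type} (p q : V → A.carrier) (h : ∀ v, R (p v) (q v)) (t : Trm σ V) :
    R (A.evalTrm p t) (A.evalTrm q t) := by
  induction t with
  | var v => exact h v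
  | op f ts ih =>
    simp only [Alg.evalTrm]
    exact hR f _ _ ih

/-- Alternating chains `β ∘ δ ∘ β ∘ ... ∘ β` with `n` occurrences of `δ`. -/
def Ch (β δ : Congruence A) : ℕ → A.carrier → A.carrier → Prop
  | 0, a, b => β.rel a b
  | n + 1, a, b => ∃ c d, β.rel a c ∧ δ.rel c d ∧ Ch β δ n d b

theorem Ch.compat (β δ : Congruence A) (n : ℕ) (f : σ.ops)
    (a b : Fin (σ.arity f) → A.carrier) (h : ∀ i, Ch β δ n (a i) (b i)) :
    Ch β δ n (A.interp f a) (A.interp f b) := by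
  induction n generalizing a b with
  | zero => exact β.compat f a b h
  | succ n ih =>
    choose c d h1 h2 h3 using h
    exact ⟨_, _, β.compat f _ _ h1, δ.compat f _ _ h2, ih _ _ h3⟩

theorem Ch.cons {β δ : Congruence A} {n : ℕ} {a b c : A.carrier}
    (h : β.rel a b) (h' : Ch β δ n b c) : Ch β δ n a c := by
  cases n with
  | zero => exact β.iseqv.trans h h'
  | succ n =>
    obtain ⟨e, d, h1, h2, h3⟩ := h'
    exact ⟨e, d, β.iseqv.trans h h1, h2, h3⟩

theorem Ch.trans {β δ : Congruence A} {n m : ℕ} {a b c : A.carrier}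
    (h : Ch β δ n a b) (h' : Ch β δ m b c) : Ch β δ (n + m) a c := by
  induction n generalizing a with
  | zero => rw [Nat.zero_add]; exact Ch.cons h h'
  | succ n ih =>
    obtain ⟨e, d, h1, h2, h3⟩ := h
    rw [Nat.succ_add]
    exact ⟨e, d, h1, h2, ih h3⟩

theorem Ch.symm {β δ : Congruence A} {n : ℕ} {a b : A.carrier}
    (h : Ch β δ n a b) : Ch β δ n b a := by
  induction n generalizing a with
  | zero => exact β.iseqv.symm h
  | succ n ih =>
    obtain ⟨e, d, h1, h2, h3⟩ := h
    have : Ch β δ 1 d a :=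
      ⟨d, e, β.iseqv.refl d, δ.iseqv.symm h2, β.iseqv.symm h1⟩
    exact (ih h3).trans this

theorem Ch.mono {β δ : Congruence A} {n m : ℕ} (hnm : n ≤ m) {a b : A.carrier}
    (h : Ch β δ n a b) : Ch β δ m a b := by
  induction hnm with
  | refl => exact h
  | step _ ih => exact ⟨a, a, β.iseqv.refl a, δ.iseqv.refl a, ih⟩

/-- The join as the union of alternating chains. -/
def joinC (β δ : Congruence A) : Congruence A where
  rel a b := ∃ n, Ch β δ n a b
  iseqv := ⟨fun a => ⟨0, β.iseqv.refl a⟩, fun ⟨n, h⟩ => ⟨n, h.symm⟩,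
    fun ⟨_, h⟩ ⟨_, h'⟩ => ⟨_, h.trans h'⟩⟩
  compat f a b h := by
    choose n hn using h
    exact ⟨Finset.univ.sup n, Ch.compat β δ _ f a b fun i =>
      (hn i).mono (Finset.le_sup (Finset.mem_univ i))⟩

theorem sup_le_joinC (β δ : Congruence A) : β ⊔ δ ≤ joinC β δ :=
  sup_le (fun _ _ h => ⟨0, h⟩)
    (fun a b h => ⟨1, a, b, β.iseqv.refl a, h, β.iseqv.refl b⟩)

/-- The meet as an intersection. -/
def meetC (β δ : Congruence A) : Congruence A where
  rel a b := β.rel a b ∧ δ.rel a b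
  iseqv := ⟨fun a => ⟨β.iseqv.refl a, δ.iseqv.refl a⟩,
    fun h => ⟨β.iseqv.symm h.1, δ.iseqv.symm h.2⟩,
    fun h h' => ⟨β.iseqv.trans h.1 h'.1, δ.iseqv.trans h.2 h'.2⟩⟩
  compat f a b h := ⟨β.compat f a b fun i => (h i).1, δ.compat f a b fun i => (h i).2⟩

theorem meetC_le_inf (β δ : Congruence A) : meetC β δ ≤ β ⊓ δ :=
  le_inf (fun _ _ h => h.1) (fun _ _ h => h.2)

/-- One-place form of the centralizer condition. -/
theorem cent_update {α x y : Congruence A} (hC : Centralizes α x y) {n : ℕ}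
    (T : Trm σ (Fin n)) (i : Fin n) (e e' : Fin n → A.carrier) {a b : A.carrier}
    (he : ∀ j, α.rel (e j) (e' j)) (hab : x.rel a b)
    (h : y.rel (A.evalTrm (Function.update e i a) T) (A.evalTrm (Function.update e i b) T)) :
    y.rel (A.evalTrm (Function.update e' i a) T)
      (A.evalTrm (Function.update e' i b) T) := by
  have key : ∀ (g : Fin n → A.carrier) (u : A.carrier),
      A.evalTrm (Sum.elim g (fun _ : Fin 1 => u))
        (ren (fun j => if j = i then Sum.inr 0 else Sum.inl j) T)
      = A.evalTrm (Function.update g i u) T := by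
    intro g u
    rw [eval_ren]
    congr 1
    funext j
    by_cases hj : j = i
    · subst hj; simp
    · simp [hj]
  have := hC n 1 (ren (fun j => if j = i then Sum.inr 0 else Sum.inl j) T) e e'
    (fun _ => a) (fun _ => b) he (fun _ => hab)
  rw [key, key, key, key] at this
  exact this h

theorem eval_rel (c : Congruence A) {V : Type} {p q : V → A.carrier}
    (h : ∀ v, c.rel (p v) (q v)) (t : Trm σ V) :
    c.rel (A.evalTrm p t) (A.evalTrm q t) :=
  eval_compat c.rel c.compat p q h t

/-- The inductive step at a single place of the Taylor term. -/
theorem place {β x y : Congruence A} (hyx : y ≤ x) {n N : ℕ} (T : Trm σ (Fin n))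
    (IH : ∀ a b, Ch β y N a b → x.rel a b → y.rel a b)
    {a b c d : A.carrier} (hab : x.rel a b) (hac : β.rel a c) (hcd : y.rel c d)
    (hdb : Ch β y N d b) (i : Fin n) (w z : Fin n → Bool) (hw : w i = true)
    (hz : z i = false)
    (hwz : A.evalTrm (fun j => cond (w j) d c) T = A.evalTrm (fun j => cond (z j) d c) T) :
    y.rel (A.evalTrm (Function.update (fun _ => c) i a) T)
      (A.evalTrm (Function.update (fun _ => c) i b) T) := by
  have hy : ∀ (v : Fin n → Bool) (e : A.carrier),
      y.rel (A.evalTrm (Function.update (fun _ => c) i e) T)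
        (A.evalTrm (Function.update (fun j => cond (v j) d c) i e) T) := by
    intro v e
    apply eval_rel
    intro j
    by_cases hj : j = i
    · subst hj; simp only [Function.update_self]; exact y.iseqv.refl _
    · simp only [Function.update_of_ne hj]
      cases v j
      · exact y.iseqv.refl _
      · exact hcd
  have hx : x.rel (A.evalTrm (Function.update (fun _ => c) i a) T)
      (A.evalTrm (Function.update (fun _ => c) i b) T) := by
    apply eval_rel
    intro j
    by_cases hj : j = i
    · subst hj; simp only [Function.update_self]; exact hab
    · simp only [Function.update_of_ne hj]; exact x.iseqv.refl _
  have h1 : β.rel (A.evalTrm (Function.update (fun j => cond (z j) d c) i a) T)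
      (A.evalTrm (fun j => cond (z j) d c) T) := by
    apply eval_rel
    intro j
    by_cases hj : j = i
    · subst hj; simp only [Function.update_self, hz]; exact hac
    · simp only [Function.update_of_ne hj]; exact β.iseqv.refl _
  have h2 : Ch β y N (A.evalTrm (fun j => cond (w j) d c) T)
      (A.evalTrm (Function.update (fun j => cond (w j) d c) i b) T) := by
    apply eval_compat _ (Ch.compat β y N)
    intro j
    by_cases hj : j = i
    · subst hj; simp only [Function.update_self, hw]; exact hdb
    · simp only [Function.update_of_ne hj]
      exact Ch.mono (Nat.zero_le N) (β.iseqv.refl _)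
  rw [hwz] at h2
  have h3 := IH _ _ (Ch.cons h1 h2)
    (x.iseqv.trans (x.iseqv.symm (hyx _ _ (hy z a)))
      (x.iseqv.trans hx (hyx _ _ (hy w b))))
  exact y.iseqv.trans (hy z a) (y.iseqv.trans h3 (y.iseqv.symm (hy w b)))

theorem core (V : Variety σ) (hT : HasTaylorTrm V) (hA : V.Mem A)
    {β α x y : Congruence A} (hyx : y ≤ x) (hxα : x ≤ α) (hβα : β ≤ α)
    (hm : β ⊓ x ≤ y) (hC : Centralizes α x y) :
    ∀ (N : ℕ) (a b : A.carrier), Ch β y N a b → x.rel a b → y.rel a b := by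
  obtain ⟨n, T, -, hid, htay⟩ := hT
  intro N
  induction N with
  | zero => exact fun a b h h' => hm _ _ (meetC_le_inf β x a b ⟨h, h'⟩)
  | succ N IH =>
    rintro a b ⟨c, d, hac, hcd, hdb⟩ hab
    have hplace : ∀ i : Fin n,
        y.rel (A.evalTrm (Function.update (fun _ => c) i a) T)
          (A.evalTrm (Function.update (fun _ => c) i b) T) := by
      intro i
      obtain ⟨w, z, hne, hwz⟩ := htay i
      have hwz' := hwz A hA d c
      cases hw : w i
      · have hz : z i = true := by
          cases hz : z i
          · exact absurd (hw.trans hz.symm) hne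
          · rfl
        exact place hyx T IH hab hac hcd hdb i z w hz hw hwz'.symm
      · have hz : z i = false := by
          cases hz : z i
          · rfl
          · exact absurd (hw.trans hz.symm) hne
        exact place hyx T IH hab hac hcd hdb i w z hw hz hwz'
    have hca : α.rel c a := α.iseqv.symm (hβα _ _ hac)
    have hcb : α.rel c b := α.iseqv.trans hca (hxα _ _ hab)
    have steps : ∀ k : ℕ, k ≤ n →
        y.rel a (A.evalTrm (fun j : Fin n => if j.val < k then b else a) T) := by
      intro k
      induction k with
      | zero =>
        intro _
        have := hid A hA a
        simp only [Nat.not_lt_zero, if_false, this]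
        exact y.iseqv.refl a
      | succ k ih =>
        intro hk
        refine y.iseqv.trans (ih (by omega)) ?_
        have h := cent_update hC T ⟨k, hk⟩ (fun _ => c)
          (fun j : Fin n => if j.val < k then b else a)
          (by intro j; split_ifs; exacts [hcb, hca]) hab (hplace _)
        convert h using 2
        · funext j
          by_cases hj : j = ⟨k, hk⟩
          · subst hj; simp
          · simp [hj]
        · funext j
          by_cases hj : j = ⟨k, hk⟩
          · subst hj; simp
          · have : j.val ≠ k := fun h => hj (Fin.ext h)
            simp only [Function.update_of_ne hj]
            congr 1
            apply propext
            omega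
    have hfin := steps n le_rfl
    have hb := hid A hA b
    simp only [Fin.is_lt, if_true, hb] at hfin
    exact hfin

theorem second (V : Variety σ) (hT : HasTaylorTrm V) (hA : V.Mem A)
    {z β δ θ α : Congruence A} (hpent : IsPentagon z β δ θ α)
    (x y : Congruence A) (hδy : δ ≤ y) (hyx : y < x) (hxθ : x ≤ θ) :
    ¬ Centralizes α x y := by
  intro hC
  obtain ⟨-, h1, h2, h3, h4⟩ := hpent
  have hθα : θ ≤ α := h4 ▸ le_sup_right
  have hβα : β ≤ α := h4 ▸ le_sup_left
  have hm : β ⊓ x ≤ y :=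
    (inf_le_inf_left β hxθ).trans ((h1.trans h2.symm).le.trans (inf_le_right.trans hδy))
  have hj : x ≤ joinC β y :=
    (hxθ.trans hθα).trans (h3.symm.le.trans ((sup_le_sup_left hδy β).trans (sup_le_joinC β y)))
  refine absurd hyx (not_lt_of_ge ?_)
  intro a b hab
  obtain ⟨N, hN⟩ := hj a b hab
  exact core V hT hA hyx.le (hxθ.trans hθα) hβα hm hC N a b hN hab

end PentAux

/-- If `V` has a Taylor term and `A ∈ V` has a pentagon `{0', β, δ, θ, α}` in
its congruence lattice, then `[α,x]_δ = x` for every `x ∈ I[δ,θ]`;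
equivalently, `C(α,x;y)` fails whenever `δ ≤ y < x ≤ θ`. -/
theorem memoir_pentagon {σ : Sig} (V : Variety σ) (hT : HasTaylorTrm V)
    (A : Alg σ) (hA : V.Mem A) (z β δ θ α : Congruence A)
    (hpent : IsPentagon z β δ θ α) :
    (∀ x : Congruence A, δ ≤ x → x ≤ θ → relCommC α x δ = x) ∧
    (∀ x y : Congruence A, δ ≤ y → y < x → x ≤ θ → ¬ Centralizes α x y) := by
  have h2 := fun x y => PentAux.second V hT hA hpent x y
  refine ⟨fun x hδx hxθ => ?_, h2⟩
  have hle : relCommC α x δ ≤ x := by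
    refine sInf_le ⟨hδx, ?_⟩
    intro m n t a b u v _ huv _
    apply PentAux.eval_rel
    rintro (i | j)
    · exact x.iseqv.refl _
    · exact huv j
  by_contra hne
  refine h2 x (relCommC α x δ) (le_sInf fun γ hγ => hγ.1) (lt_of_le_of_ne hle hne) hxθ ?_
  intro m n t a b u v hab huv h γ hγ
  exact hγ.2 m n t a b u v hab huv (h γ hγ)
end
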